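/- For all integers k ≥ 2 and 1 ≤ l ≤ k, the ℚ-subspace of ℚ[Sₖ] spanned by the conjugates {σ·(ẽ⁽ˡ⁾ₖ * τₖ)·σ⁻¹ : σ ∈ Sₖ} has dimension equal to the coefficient of q^{l−1} in the polynomial q(q+1)(q+2)⋯(q+k−2). -/

import Mathlib

noncomputable section

/-- Number of descents of a permutation of `Fin n`. -/
def descents {n : ℕ} (σ : Equiv.Perm (Fin n)) : ℕ :=
  (Finset.univ.filter fun p : Fin n × Fin n =>
    (p.2 : ℕ) = (p.1 : ℕ) + 1 ∧ σ p.2 < σ p.1).card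

/-- `aCoeff n l j` is the coefficient of `X^l` in `(1/n!) ∏_{i=1}^n (X - j + i) ∈ ℚ[X]`. -/
def aCoeff (n l j : ℕ) : ℚ :=
  (((n.factorial : ℚ))⁻¹ • ∏ i ∈ Finset.Icc 1 n,
    (Polynomial.X + Polynomial.C ((i : ℚ) - (j : ℚ)))).coeff l

/-- The `k`-cycle `τₖ` sending `1 ↦ k` and `i ↦ i-1` for `2 ≤ i ≤ k`. -/
def tau (k : ℕ) : Equiv.Perm (Fin k) := (finRotate k)⁻¹

/-- The element `ẽ⁽ˡ⁾ₖ * τₖ = Σ_{σ∈Sₖ} aₖ^{l, des(σ)+1}·στₖσ⁻¹ ∈ ℚ[Sₖ]`. -/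
def eulConjTau (k l : ℕ) : MonoidAlgebra ℚ (Equiv.Perm (Fin k)) :=
  ∑ σ : Equiv.Perm (Fin k),
    MonoidAlgebra.single (σ * tau k * σ⁻¹) (aCoeff k l (descents σ + 1))


lemma descents_eq_sum {n : ℕ} (σ : Equiv.Perm (Fin (n+1))) :
    descents σ = ∑ i : Fin n, if σ i.succ < σ i.castSucc then 1 else 0 := by
  unfold descents
  rw [← Finset.card_filter]
  symm
  apply Finset.card_bij (fun i _ => (i.castSucc, i.succ))
  · intro i hi
    simpa using hi
  · intro i _ j _ h
    simpa using h
  · rintro ⟨a, b⟩ h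
    simp only [Finset.mem_filter, Finset.mem_univ, true_and] at h
    have ha : (a : ℕ) < n := by have := b.2; omega
    have h1 : (⟨a, ha⟩ : Fin n).castSucc = a := by ext; simp
    have h2 : (⟨a, ha⟩ : Fin n).succ = b := by ext; simp [h.1]
    refine ⟨⟨a, ha⟩, ?_, ?_⟩
    · simp only [Finset.mem_filter, Finset.mem_univ, true_and]
      rw [h1, h2]; exact h.2
    · rw [h1, h2]

lemma card_count (n m : ℕ) (d : Fin n → ℕ) (hd : ∀ i, d i ≤ 1) :
    Fintype.card {a : Fin (n+1) → Fin m // ∀ i : Fin n, (a i.castSucc : ℕ) + d i ≤ a i.succ}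
      = (m + ∑ j, (1 - d j)).choose (n+1) := by
  set C := ∑ j, (1 - d j) with hC
  set c : Fin (n+1) → ℕ := fun i => ∑ j : Fin n, if j.castSucc < i then 1 - d j else 0 with hc
  have c_succ : ∀ i : Fin n, c i.succ = c i.castSucc + (1 - d i) := by
    intro i
    have : ∀ j : Fin n, (if j.castSucc < i.succ then 1 - d j else 0)
        = (if j.castSucc < i.castSucc then 1 - d j else 0) + if j = i then 1 - d j else 0 := by
      intro j
      simp only [Fin.lt_def, Fin.ext_iff, Fin.val_castSucc, Fin.val_succ]
      split_ifs <;> omega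
    simp only [hc, this, Finset.sum_add_distrib]
    simp
  have c_zero : c 0 = 0 := by simp [hc]
  have c_last : c (Fin.last n) = C := by
    simp [hc, hC, Fin.castSucc_lt_last]
  have c_le : ∀ i, c i ≤ C := by
    intro i
    apply Finset.sum_le_sum
    intro j _
    split_ifs <;> simp
  have e1 : Fintype.card (Fin (n+1) ↪o Fin (m + C)) = (m+C).choose (n+1) := by
    rw [Fintype.card_congr (Set.powersetCard.ofFinEmbEquiv), ← Nat.card_eq_fintype_card,
      Set.powersetCard.card, Nat.card_eq_fintype_card, Fintype.card_fin]
  rw [← e1]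
  let F : {a : Fin (n+1) → Fin m // ∀ i : Fin n, (a i.castSucc : ℕ) + d i ≤ a i.succ} →
      (Fin (n+1) ↪o Fin (m + C)) := fun a => OrderEmbedding.ofStrictMono
        (fun i => ⟨a.1 i + c i, by have := (a.1 i).2; have := c_le i; omega⟩) (by
          rw [Fin.strictMono_iff_lt_succ]
          intro i
          have h1 := c_succ i
          have h2 := a.2 i
          have h3 := hd i
          simp only [Fin.lt_def]
          omega)
  apply Fintype.card_congr (Equiv.ofBijective F ⟨?_, ?_⟩)
  · intro a b hab
    ext i
    have := DFunLike.congr_fun hab i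
    simp only [F, OrderEmbedding.coe_ofStrictMono, Fin.ext_iff] at this
    omega
  · intro b
    have hb : ∀ i : Fin n, (b i.castSucc : ℕ) < b i.succ := fun i =>
      b.strictMono i.castSucc_lt_succ
    have h1 : ∀ i, c i ≤ b i := by
      intro i
      induction i using Fin.induction with
      | zero => simp [c_zero]
      | succ i ih => have := c_succ i; have := hb i; omega
    have h2 : ∀ i, (b i : ℕ) < m + c i := by
      intro i
      induction i using Fin.reverseInduction with
      | last => rw [c_last]; exact (b _).2
      | cast i ih => have := c_succ i; have := hb i; omega
    refine ⟨⟨fun i => ⟨b i - c i, by have := h1 i; have := h2 i; omega⟩, ?_⟩, ?_⟩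
    · intro i
      have := c_succ i; have := hb i; have := hd i; have := h1 i.castSucc
      have := h1 i.succ
      simp only
      omega
    · ext i
      have := h1 i
      simp only [F, OrderEmbedding.coe_ofStrictMono]
      omega

lemma sort_iff {n m : ℕ} (w : Fin (n+1) → Fin m) (σ : Equiv.Perm (Fin (n+1))) :
    Tuple.sort w = σ ↔ ∀ i : Fin n, ((w ∘ σ) i.castSucc : ℕ) +
      (if σ i.succ < σ i.castSucc then 1 else 0) ≤ (w ∘ σ) i.succ := by
  rw [eq_comm, Tuple.eq_sort_iff', Fin.strictMono_iff_lt_succ]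
  apply forall_congr'
  intro i
  have hne : σ i.castSucc ≠ σ i.succ := by simp [Fin.castSucc_lt_succ.ne]
  have : ((σ.trans (Tuple.graphEquiv₁ w)) i.castSucc < (σ.trans (Tuple.graphEquiv₁ w)) i.succ) ↔
    toLex (w (σ i.castSucc), σ i.castSucc) < toLex (w (σ i.succ), σ i.succ) := Iff.rfl
  rw [this, Prod.Lex.toLex_lt_toLex]
  simp only [Fin.lt_def, Fin.ext_iff, Function.comp] at *
  split_ifs <;> omega

lemma card_sort (n m : ℕ) (σ : Equiv.Perm (Fin (n+1))) :
    (Finset.univ.filter fun w : Fin (n+1) → Fin m => Tuple.sort w = σ).card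
      = (m + n - descents σ).choose (n+1) ∧ descents σ ≤ n := by
  have hle : descents σ ≤ n := by
    rw [descents_eq_sum]
    calc _ ≤ ∑ i : Fin n, 1 := Finset.sum_le_sum (by intro i _; split_ifs <;> simp)
      _ = n := by simp
  refine ⟨?_, hle⟩
  have := card_count n m (fun i => if σ i.succ < σ i.castSucc then 1 else 0)
    (by intro i; split_ifs <;> simp)
  rw [← Fintype.card_subtype]
  have e : m + ∑ j : Fin n, (1 - (if σ j.succ < σ j.castSucc then 1 else 0)) = m + n - descents σ := by
    have : (∑ j : Fin n, (1 - (if σ j.succ < σ j.castSucc then 1 else 0))) + descents σ = n := by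
      rw [descents_eq_sum, ← Finset.sum_add_distrib]
      calc _ = ∑ i : Fin n, 1 := Finset.sum_congr rfl (by intro i _; split_ifs <;> simp)
        _ = n := by simp
    omega
  rw [e] at this
  rw [← this]
  apply Fintype.card_congr
  refine (Equiv.arrowCongr σ.symm (Equiv.refl (Fin m))).subtypeEquiv ?_
  intro w
  rw [sort_iff]
  rfl

/-- Adams operation. -/
def psi (k m : ℕ) : MonoidAlgebra ℚ (Equiv.Perm (Fin k)) :=
  ∑ w : Fin k → Fin m, MonoidAlgebra.single (Tuple.sort w) 1

lemma psi_mul (k m n : ℕ) : psi k m * psi k n = psi k (n * m) := by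
  unfold psi
  rw [Finset.sum_mul_sum, ← Finset.sum_product']
  let F : (Fin k → Fin m) × (Fin k → Fin n) → (Fin k → Fin (n*m)) := fun p x =>
    finProdFinEquiv (p.2 ((Tuple.sort p.1)⁻¹ x), p.1 x)
  have hF : Function.Injective F := by
    rintro ⟨w, v⟩ ⟨w', v'⟩ h
    have h1 : ∀ x, v ((Tuple.sort w)⁻¹ x) = v' ((Tuple.sort w')⁻¹ x) ∧ w x = w' x := by
      intro x
      have := congrFun h x
      simpa [F] using this
    have hw : w = w' := funext fun x => (h1 x).2
    subst hw
    have hv : v = v' := by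
      funext x
      have := (h1 (Tuple.sort w x)).1
      simpa using this
    rw [hv]
  have hB : Function.Bijective F := by
    rw [Fintype.bijective_iff_injective_and_card]
    refine ⟨hF, ?_⟩
    simp [mul_pow, mul_comm]
  rw [Finset.univ_product_univ]
  refine Fintype.sum_bijective F hB _ _ ?_
  rintro ⟨w, v⟩
  rw [MonoidAlgebra.single_mul_single, mul_one]
  congr 1
  rw [Tuple.eq_sort_iff]
  have hw := Tuple.eq_sort_iff.1 (rfl : Tuple.sort w = _)
  have hv := Tuple.eq_sort_iff.1 (rfl : Tuple.sort v = _)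
  set σ := Tuple.sort w
  set ρ := Tuple.sort v
  have hval : ∀ i, (F (w, v) ((σ * ρ) i) : ℕ) = w (σ (ρ i)) + m * v (ρ i) := by
    intro i
    have : σ⁻¹ (σ (ρ i)) = ρ i := by simp
    simp [F, finProdFinEquiv, σ]
  have key : ∀ i j, i < j → (v (ρ i) < v (ρ j)) ∨ (v (ρ i) = v (ρ j) ∧ w (σ (ρ i)) ≤ w (σ (ρ j)) ∧
      (w (σ (ρ i)) = w (σ (ρ j)) → σ (ρ i) < σ (ρ j))) := by
    intro i j hij
    rcases (hv.1 hij.le).lt_or_eq with h | h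
    · exact Or.inl h
    · right
      have h' := hv.2 i j hij h
      exact ⟨h, hw.1 h'.le, hw.2 _ _ h'⟩
  have key2 : ∀ i j, i < j → v (ρ i) < v (ρ j) → 
      (F (w, v) ((σ * ρ) i) : ℕ) < F (w, v) ((σ * ρ) j) := by
    intro i j _ h
    rw [hval, hval]
    have h1 := (w (σ (ρ i))).2
    have h2 : m * (v (ρ i) + 1 : ℕ) ≤ m * v (ρ j) := Nat.mul_le_mul_left _ h
    rw [mul_add] at h2
    omega
  constructor
  · intro i j hij
    rcases hij.lt_or_eq with hij | hij
    · rcases key i j hij with h | ⟨h1, h2, _⟩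
      · exact (key2 i j hij h).le
      · rw [Function.comp, Function.comp, Fin.le_def, hval, hval, h1]
        exact Nat.add_le_add_right h2 _
    · rw [hij]
  · intro i j hij heq
    rcases key i j hij with h | ⟨h1, h2, h3⟩
    · have := key2 i j hij h
      rw [heq] at this
      exact absurd this (lt_irrefl _)
    · apply h3
      have := congrArg Fin.val heq
      rw [hval, hval, h1] at this
      ext
      omega

/-- Eulerian element. -/
def eul (k l : ℕ) : MonoidAlgebra ℚ (Equiv.Perm (Fin k)) :=
  ∑ σ : Equiv.Perm (Fin k), MonoidAlgebra.single σ (aCoeff k l (descents σ + 1))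

lemma sum_aCoeff (n m s : ℕ) (hs : s ≤ n) :
    ∑ l ∈ Finset.range (n+2), (m : ℚ)^l * aCoeff (n+1) l (s+1)
      = ((m + n - s).choose (n+1) : ℚ) := by
  unfold aCoeff
  set P : Polynomial ℚ := (((n+1).factorial : ℚ))⁻¹ • ∏ i ∈ Finset.Icc 1 (n+1),
    (Polynomial.X + Polynomial.C ((i : ℚ) - ((s+1 : ℕ) : ℚ))) with hP
  have hdeg : P.natDegree < n + 2 := by
    apply lt_of_le_of_lt (Polynomial.natDegree_smul_le _ _)
    rw [Polynomial.natDegree_prod_of_monic _ _ (fun i _ => Polynomial.monic_X_add_C _)]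
    simp only [Polynomial.natDegree_X_add_C]
    simp
  have h1 := Polynomial.eval_eq_sum_range' hdeg (m : ℚ)
  have h2 : P.eval (m : ℚ) = ((m + n - s).choose (n+1) : ℚ) := by
    rw [Nat.choose_eq_descFactorial_div_factorial, Nat.cast_div (Nat.factorial_dvd_descFactorial _ _)
      (by positivity), ← descPochhammer_eval_eq_descFactorial, descPochhammer_eval_eq_prod_range,
      hP, Polynomial.eval_smul, Polynomial.eval_prod, smul_eq_mul, div_eq_inv_mul]
    congr 1
    rw [← Finset.prod_range_reflect, ← Finset.Ico_add_one_right_eq_Icc, Finset.prod_Ico_eq_prod_range]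
    apply Finset.prod_congr (by simp)
    intro i hi
    have hi' : i < n + 1 := by simpa using hi
    rw [Nat.cast_sub (by omega), Nat.cast_sub (by omega), Nat.cast_sub (by omega)]
    simp
    ring
  rw [← h2, h1]
  exact Finset.sum_congr rfl fun i _ => mul_comm _ _

lemma coeff_sum_single {G : Type*} [Group G] [Fintype G] (f : G → ℚ) (g : G) :
    (∑ σ, MonoidAlgebra.single σ (f σ)).coeff g = f g := by
  classical
  simp [MonoidAlgebra.coeff_sum, Finsupp.finsetSum_apply, Finsupp.single_apply]

lemma coeff_eul (k l : ℕ) (σ : Equiv.Perm (Fin k)) :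
    (eul k l).coeff σ = aCoeff k l (descents σ + 1) := coeff_sum_single _ _

lemma psi_eq (n m : ℕ) :
    psi (n+1) m = ∑ l ∈ Finset.range (n+2), (m : ℚ)^l • eul (n+1) l := by
  classical
  ext σ
  have h := card_sort n m σ
  have h2 := sum_aCoeff n m _ h.2
  simp only [MonoidAlgebra.coeff_sum, Finsupp.finsetSum_apply, MonoidAlgebra.coeff_smul_apply, coeff_eul,
    smul_eq_mul]
  rw [h2, ← h.1]
  simp [psi, MonoidAlgebra.coeff_sum, Finsupp.finsetSum_apply, Finsupp.single_apply]

lemma coeff_compare (K : ℕ) (a b : ℕ → ℚ)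
    (h : ∀ m : ℕ, ∑ i ∈ Finset.range K, (m : ℚ)^i * a i = ∑ i ∈ Finset.range K, (m : ℚ)^i * b i)
    (i : ℕ) (hi : i < K) : a i = b i := by
  let P (a : ℕ → ℚ) : Polynomial ℚ := ∑ i ∈ Finset.range K, Polynomial.monomial i (a i)
  have hc : ∀ a : ℕ → ℚ, (P a).coeff i = a i := by
    intro a
    simp [P, Polynomial.coeff_monomial, hi]
  have : P a = P b := by
    apply Polynomial.eq_of_infinite_eval_eq
    apply Set.infinite_of_injective_forall_mem (f := fun m : ℕ => (m : ℚ)) Nat.cast_injective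
    intro m
    simpa [P, Polynomial.eval_finsetSum, mul_comm] using h m
  rw [← hc a, ← hc b, this]

lemma eul_idem (n l : ℕ) (hl : l < n + 2) : eul (n+1) l * eul (n+1) l = eul (n+1) l := by
  ext π
  have h : ∀ m' m : ℕ, ∑ i ∈ Finset.range (n+2), (m : ℚ)^i *
      (∑ j ∈ Finset.range (n+2), (m' : ℚ)^j * (eul (n+1) i * eul (n+1) j).coeff π) =
      ∑ i ∈ Finset.range (n+2), (m : ℚ)^i * ((m' : ℚ)^i * (eul (n+1) i).coeff π) := by
    intro m' m
    have := congrArg (fun x => x.coeff π) (psi_mul (n+1) m m')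
    simp only [psi_eq, Finset.sum_mul_sum, MonoidAlgebra.coeff_sum, Finsupp.finsetSum_apply,
      smul_mul_smul_comm, MonoidAlgebra.coeff_smul_apply, smul_eq_mul] at this
    simp only [Finset.mul_sum]
    convert this using 1
    · simp only [mul_assoc]
    · apply Finset.sum_congr rfl
      intro i _
      push_cast
      ring
  have h1 : ∀ m' : ℕ, ∑ j ∈ Finset.range (n+2), (m' : ℚ)^j * (eul (n+1) l * eul (n+1) j).coeff π =
      ∑ j ∈ Finset.range (n+2), (m' : ℚ)^j * (if j = l then (eul (n+1) l).coeff π else 0) := by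
    intro m'
    rw [coeff_compare _ _ _ (h m') l hl]
    simp [hl]
  simpa using coeff_compare _ _ _ h1 l hl

/-- Rotation by `j`. -/
def rot {n : ℕ} (j : Fin (n+1)) : Equiv.Perm (Fin (n+1)) := Equiv.addRight j

lemma rot_apply {n : ℕ} (j x : Fin (n+1)) : rot j x = x + j := rfl

lemma rot_mul {n : ℕ} (i j : Fin (n+1)) : rot i * rot j = rot (i + j) := by
  ext x
  simp [rot_apply, add_assoc, add_comm j i]

lemma rot_zero {n : ℕ} : rot (0 : Fin (n+1)) = 1 := by
  ext x
  simp [rot_apply]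

lemma rot_inv {n : ℕ} (i : Fin (n+1)) : (rot i)⁻¹ = rot (-i) := by
  rw [inv_eq_iff_mul_eq_one, rot_mul, add_neg_cancel, rot_zero]

lemma tau_eq {n : ℕ} : tau (n+1) = rot (-1) := by
  unfold tau
  rw [← rot_inv]
  congr 1
  ext x
  rw [finRotate_apply, rot_apply]

/-- Cyclic descents. -/
def cdes {n : ℕ} (σ : Equiv.Perm (Fin (n+1))) : ℕ :=
  ∑ i : Fin (n+1), if σ (i+1) < σ i then 1 else 0

lemma descents_add {n : ℕ} (σ : Equiv.Perm (Fin (n+1))) :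
    descents σ + (if σ 0 < σ (Fin.last n) then 1 else 0) = cdes σ := by
  rw [descents_eq_sum, cdes, Fin.sum_univ_castSucc]
  congr 1
  · apply Finset.sum_congr rfl
    intro i _
    rw [Fin.coeSucc_eq_succ]
  · rw [Fin.last_add_one]

lemma cdes_mul_rot {n : ℕ} (σ : Equiv.Perm (Fin (n+1))) (j : Fin (n+1)) :
    cdes (σ * rot j) = cdes σ := by
  unfold cdes
  rw [← Equiv.sum_comp (rot j) (fun i => if σ (i+1) < σ i then 1 else 0)]
  apply Finset.sum_congr rfl
  intro i _
  have h1 : (σ * rot j) (i + 1) = σ (rot j i + 1) := by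
    rw [Equiv.Perm.mul_apply, rot_apply, rot_apply, add_right_comm i 1 j]
  rw [h1]
  rfl

lemma cdes_rot_one_mul {n : ℕ} (σ : Equiv.Perm (Fin (n+1))) :
    cdes (rot 1 * σ) = cdes σ := by
  unfold cdes
  have key : ∀ x y : Fin (n+1), (if x + 1 < y + 1 then 1 else 0) + (if y = Fin.last n then 1 else 0)
      = (if x < y then 1 else 0) + (if x = Fin.last n then 1 else 0) := by
    intro x y
    simp only [Fin.lt_def, Fin.val_add_one, Fin.ext_iff, Fin.val_last]
    have := x.2
    have := y.2
    split_ifs <;> omega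
  have h : (∑ i, (if (rot 1 * σ : Equiv.Perm (Fin (n+1))) (i+1) <
      (rot 1 * σ : Equiv.Perm (Fin (n+1))) i then 1 else 0))
      + (∑ i, if σ i = Fin.last n then 1 else 0) =
      (∑ i, if σ (i+1) < σ i then 1 else 0) + (∑ i, if σ (i+1) = Fin.last n then 1 else 0) := by
    rw [← Finset.sum_add_distrib, ← Finset.sum_add_distrib]
    apply Finset.sum_congr rfl
    intro i _
    simp only [Equiv.Perm.mul_apply, rot_apply]
    exact key _ _
  have h2 : (∑ i, if σ (i+1) = Fin.last n then 1 else 0) = ∑ i, if σ i = Fin.last n then 1 else 0 :=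
    Equiv.sum_comp (rot 1) (fun i => if σ i = Fin.last n then 1 else 0)
  omega

lemma cdes_rot_mul {n : ℕ} (σ : Equiv.Perm (Fin (n+1))) (j : Fin (n+1)) :
    cdes (rot j * σ) = cdes σ := by
  induction j using Fin.induction with
  | zero => rw [rot_zero, one_mul]
  | succ i ih =>
    rw [← Fin.coeSucc_eq_succ, add_comm i.castSucc 1, ← rot_mul, mul_assoc, cdes_rot_one_mul, ih]

lemma cdes_one {n : ℕ} (hn : 1 ≤ n) : cdes (1 : Equiv.Perm (Fin (n+1))) = 1 := by
  rw [← descents_add]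
  have h1 : descents (1 : Equiv.Perm (Fin (n+1))) = 0 := by
    rw [descents_eq_sum]
    apply Finset.sum_eq_zero
    intro i _
    simp [Fin.lt_def]
  rw [h1, if_pos]
  simp [Fin.lt_def]
  omega

lemma sum_rot {n : ℕ} (σ : Equiv.Perm (Fin (n+1))) (F : ℕ → ℚ) :
    ∑ j, F (descents (σ * rot j) + 1) =
      (n+1) * F (cdes σ + 1) + cdes σ * (F (cdes σ) - F (cdes σ + 1)) := by
  have h : ∀ j, F (descents (σ * rot j) + 1) = F (cdes σ + 1) +
      ((if σ j < σ (j + -1) then 1 else 0 : ℕ) : ℚ) * (F (cdes σ) - F (cdes σ + 1)) := by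
    intro j
    have h1 := descents_add (σ * rot j)
    rw [cdes_mul_rot] at h1
    simp only [Equiv.Perm.mul_apply, rot_apply, zero_add] at h1
    have h2 : Fin.last n + j = j + -1 := by
      rw [add_comm (Fin.last n) j]
      congr 1
      rw [eq_neg_iff_add_eq_zero, Fin.last_add_one]
    rw [h2] at h1
    rw [← h1]
    split_ifs <;> simp
  simp only [h, Finset.sum_add_distrib, ← Finset.sum_mul, ← Nat.cast_sum]
  have h3 : (∑ j, if σ j < σ (j + -1) then 1 else 0) = cdes σ := by
    unfold cdes
    rw [← Equiv.sum_comp (rot 1)]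
    simp [rot_apply]
  rw [h3]
  simp

/-- The averaging idempotent of the cyclic group. -/
def avg (n : ℕ) : MonoidAlgebra ℚ (Equiv.Perm (Fin (n+1))) :=
  ((n : ℚ) + 1)⁻¹ • ∑ j : Fin (n+1), MonoidAlgebra.single (rot j) 1

lemma rot_mul_avg {n : ℕ} (i : Fin (n+1)) : MonoidAlgebra.single (rot i) 1 * avg n = avg n := by
  unfold avg
  rw [mul_smul_comm, Finset.mul_sum]
  congr 1
  simp only [MonoidAlgebra.single_mul_single, rot_mul, mul_one]
  exact Equiv.sum_comp (Equiv.addLeft i) (fun j => MonoidAlgebra.single (rot j) (1:ℚ))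

lemma avg_mul_of_inv {n : ℕ} (x : MonoidAlgebra ℚ (Equiv.Perm (Fin (n+1))))
    (hx : ∀ i : Fin (n+1), MonoidAlgebra.single (rot i) 1 * x = x) : avg n * x = x := by
  unfold avg
  rw [smul_mul_assoc, Finset.sum_mul]
  simp only [hx]
  rw [Finset.sum_const, Finset.card_univ, Fintype.card_fin, ← Nat.cast_smul_eq_nsmul ℚ, smul_smul]
  push_cast
  rw [inv_mul_cancel₀ (by positivity), one_smul]

lemma coeff_eul_avg (n l : ℕ) (σ : Equiv.Perm (Fin (n+1))) :
    (eul (n+1) l * avg n).coeff σ = ((n:ℚ)+1)⁻¹ * ((n+1) * aCoeff (n+1) l (cdes σ + 1) +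
      cdes σ * (aCoeff (n+1) l (cdes σ) - aCoeff (n+1) l (cdes σ + 1))) := by
  rw [← sum_rot σ (aCoeff (n+1) l)]
  unfold avg
  rw [mul_smul_comm, Finset.mul_sum, MonoidAlgebra.coeff_smul_apply, MonoidAlgebra.coeff_sum,
    Finsupp.finsetSum_apply, smul_eq_mul]
  congr 1
  simp only [MonoidAlgebra.coeff_mul_single_apply, mul_one, coeff_eul, rot_inv]
  exact Equiv.sum_comp (Equiv.neg _) (fun j => aCoeff (n+1) l (descents (σ * rot j) + 1))

lemma rot_mul_eul_avg (n l : ℕ) (i : Fin (n+1)) :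
    MonoidAlgebra.single (rot i) 1 * (eul (n+1) l * avg n) = eul (n+1) l * avg n := by
  ext σ
  rw [MonoidAlgebra.coeff_single_mul_apply, rot_inv, coeff_eul_avg, coeff_eul_avg, cdes_rot_mul,
    one_mul]

lemma eul_avg_idem (n l : ℕ) (hl : l < n + 2) :
    (eul (n+1) l * avg n) * (eul (n+1) l * avg n) = eul (n+1) l * avg n := by
  rw [mul_assoc, avg_mul_of_inv _ (rot_mul_eul_avg n l), ← mul_assoc, eul_idem n l hl]

lemma finrank_range_mulRight {G : Type*} [Group G] [Fintype G] (x : MonoidAlgebra ℚ G)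
    (hx : x * x = x) :
    (Module.finrank ℚ (LinearMap.range (LinearMap.mulRight ℚ x)) : ℚ)
      = Fintype.card G * x.coeff 1 := by
  classical
  have b := MonoidAlgebra.basis G ℚ
  have : Module.Finite ℚ (MonoidAlgebra ℚ G) := Module.Finite.of_basis b
  have hidem : IsIdempotentElem (LinearMap.mulRight ℚ x) := by
    ext y
    simp [mul_assoc, hx]
  have h := (LinearMap.IsIdempotentElem.isProj_range _ hidem).trace
  rw [← h, LinearMap.trace_eq_matrix_trace ℚ (MonoidAlgebra.basis G ℚ), Matrix.trace]
  have : ∀ g : G, (LinearMap.toMatrix (MonoidAlgebra.basis G ℚ) (MonoidAlgebra.basis G ℚ)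
      (LinearMap.mulRight ℚ x)).diag g = x.coeff 1 := by
    intro g
    rw [Matrix.diag_apply, LinearMap.toMatrix_apply]
    have h1 : (MonoidAlgebra.basis G ℚ) g = MonoidAlgebra.single g 1 := by
      simp
    have h2 : ∀ y : MonoidAlgebra ℚ G, (MonoidAlgebra.basis G ℚ).repr y g = y.coeff g :=
      fun y => rfl
    rw [h1, h2, LinearMap.mulRight_apply, MonoidAlgebra.coeff_single_mul_apply]
    simp
  simp only [this]
  simp

lemma exists_rot {n : ℕ} (σ σ' : Equiv.Perm (Fin (n+1)))
    (h : σ' * tau (n+1) * σ'⁻¹ = σ * tau (n+1) * σ⁻¹) : ∃ j, σ' = σ * rot j := by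
  rw [tau_eq] at h
  have h1 : σ' * rot 1 * σ'⁻¹ = σ * rot 1 * σ⁻¹ := by
    have := congrArg (·⁻¹) h
    simpa [mul_assoc, rot_inv] using this
  have h2 : (σ⁻¹ * σ') * rot 1 = rot 1 * (σ⁻¹ * σ') := by
    rw [mul_inv_eq_iff_eq_mul] at h1
    rw [mul_assoc, h1]
    group
  set g := σ⁻¹ * σ' with hg
  have h3 : ∀ x, g (x + 1) = g x + 1 := fun x => by
    have := Equiv.congr_fun h2 x
    simpa only [Equiv.Perm.mul_apply, rot_apply] using this
  have h4 : ∀ x, g x = x + g 0 := by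
    intro x
    induction x using Fin.induction with
    | zero => simp
    | succ i ih => rw [← Fin.coeSucc_eq_succ, h3, ih, add_right_comm]
  refine ⟨g 0, ?_⟩
  have : g = rot (g 0) := by
    ext x
    rw [h4 x, rot_apply]
  rw [← this, hg, mul_inv_cancel_left]

/-- The linear extension of the conjugation of `τ`. -/
def conjTau (n : ℕ) : MonoidAlgebra ℚ (Equiv.Perm (Fin (n+1))) →ₗ[ℚ]
    MonoidAlgebra ℚ (Equiv.Perm (Fin (n+1))) :=
  MonoidAlgebra.mapDomainLinearMap ℚ ℚ (fun σ => σ * tau (n+1) * σ⁻¹)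

lemma conjTau_single (n : ℕ) (σ : Equiv.Perm (Fin (n+1))) (r : ℚ) :
    conjTau n (MonoidAlgebra.single σ r) = MonoidAlgebra.single (σ * tau (n+1) * σ⁻¹) r := by
  simp [conjTau]

lemma conjTau_comp_avg (n : ℕ) :
    conjTau n ∘ₗ LinearMap.mulRight ℚ (avg n) = conjTau n := by
  apply (MonoidAlgebra.basis _ ℚ).ext
  intro σ
  simp only [MonoidAlgebra.basis_apply, LinearMap.comp_apply, LinearMap.mulRight_apply,
    conjTau_single]
  unfold avg
  rw [mul_smul_comm, map_smul, Finset.mul_sum, map_sum]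
  have : ∀ j : Fin (n+1), conjTau n (MonoidAlgebra.single σ 1 * MonoidAlgebra.single (rot j) 1)
      = MonoidAlgebra.single (σ * tau (n+1) * σ⁻¹) 1 := by
    intro j
    rw [MonoidAlgebra.single_mul_single, conjTau_single, mul_one]
    congr 1
    rw [mul_inv_rev, tau_eq, mul_assoc σ, rot_mul, rot_inv, add_comm j (-1), ← rot_mul, ← rot_inv j]
    group
  simp only [this]
  rw [Finset.sum_const, Finset.card_univ, Fintype.card_fin, ← Nat.cast_smul_eq_nsmul ℚ, smul_smul]
  push_cast
  rw [inv_mul_cancel₀ (by positivity), one_smul]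

lemma exists_comp_conjTau (n : ℕ) : ∃ g : MonoidAlgebra ℚ (Equiv.Perm (Fin (n+1))) →ₗ[ℚ]
    MonoidAlgebra ℚ (Equiv.Perm (Fin (n+1))),
    g ∘ₗ conjTau n = LinearMap.mulRight ℚ (avg n) := by
  classical
  let s : Equiv.Perm (Fin (n+1)) → Equiv.Perm (Fin (n+1)) := fun c =>
    if h : ∃ σ, σ * tau (n+1) * σ⁻¹ = c then h.choose else 1
  have hs : ∀ σ, s (σ * tau (n+1) * σ⁻¹) * tau (n+1) * (s (σ * tau (n+1) * σ⁻¹))⁻¹ =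
      σ * tau (n+1) * σ⁻¹ := by
    intro σ
    have h : ∃ σ', σ' * tau (n+1) * σ'⁻¹ = σ * tau (n+1) * σ⁻¹ := ⟨σ, rfl⟩
    simp only [s, dif_pos h]
    exact h.choose_spec
  refine ⟨(MonoidAlgebra.basis _ ℚ).constr ℚ (fun c => MonoidAlgebra.single (s c) 1 * avg n), ?_⟩
  apply (MonoidAlgebra.basis _ ℚ).ext
  intro σ
  obtain ⟨j, hj⟩ := exists_rot σ _ (hs σ)
  rw [LinearMap.comp_apply, MonoidAlgebra.basis_apply, conjTau_single, ← MonoidAlgebra.basis_apply,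
    Module.Basis.constr_basis, hj, LinearMap.mulRight_apply]
  have : (MonoidAlgebra.single (σ * rot j) 1 : MonoidAlgebra ℚ (Equiv.Perm (Fin (n+1))))
    = MonoidAlgebra.single σ 1 * MonoidAlgebra.single (rot j) 1 := by
    rw [MonoidAlgebra.single_mul_single, mul_one]
  rw [this, mul_assoc, rot_mul_avg]

lemma span_eq (n l : ℕ) : Submodule.span ℚ (Set.range fun σ : Equiv.Perm (Fin (n+1)) =>
        MonoidAlgebra.single σ (1 : ℚ) * eulConjTau (n+1) l * MonoidAlgebra.single σ⁻¹ (1 : ℚ)) =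
    LinearMap.range (conjTau n ∘ₗ LinearMap.mulRight ℚ (eul (n+1) l)) := by
  rw [LinearMap.range_eq_map, ← (MonoidAlgebra.basis _ ℚ).span_eq, Submodule.map_span,
    ← Set.range_comp]
  congr 2
  funext σ
  simp only [Function.comp, MonoidAlgebra.basis_apply, LinearMap.comp_apply,
    LinearMap.mulRight_apply, eul, eulConjTau, Finset.mul_sum, Finset.sum_mul, map_sum,
    MonoidAlgebra.single_mul_single, conjTau_single, mul_one, one_mul, mul_inv_rev, mul_assoc]

lemma finrank_eq (n l : ℕ) :
    Module.finrank ℚ (LinearMap.range (conjTau n ∘ₗ LinearMap.mulRight ℚ (eul (n+1) l))) =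
    Module.finrank ℚ (LinearMap.range (LinearMap.mulRight ℚ (eul (n+1) l * avg n))) := by
  have : Module.Finite ℚ (MonoidAlgebra ℚ (Equiv.Perm (Fin (n+1)))) :=
    Module.Finite.of_basis (MonoidAlgebra.basis _ ℚ)
  obtain ⟨g, hg⟩ := exists_comp_conjTau n
  have h1 : LinearMap.mulRight ℚ (eul (n+1) l * avg n) =
      LinearMap.mulRight ℚ (avg n) ∘ₗ LinearMap.mulRight ℚ (eul (n+1) l) := by
    ext x
    simp [mul_assoc]
  apply le_antisymm
  · conv_lhs => rw [← conjTau_comp_avg, LinearMap.comp_assoc, ← h1, LinearMap.range_comp]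
    exact Submodule.finrank_map_le _ _
  · rw [h1, ← hg, LinearMap.comp_assoc, LinearMap.range_comp]
    exact Submodule.finrank_map_le _ _

lemma aCoeff_combo (n l : ℕ) (hl : 1 ≤ l) :
    (n.factorial : ℚ) * (n * aCoeff (n+1) l 2 + aCoeff (n+1) l 1) =
      ((∏ i ∈ Finset.range n, (Polynomial.X + Polynomial.C i) : Polynomial ℕ)).coeff (l - 1) := by
  obtain ⟨l, rfl⟩ : ∃ l', l = l' + 1 := ⟨l - 1, by omega⟩
  set Q : Polynomial ℚ := ∏ i ∈ Finset.range n, (Polynomial.X + Polynomial.C (i : ℚ)) with hQ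
  have hQc : ((∏ i ∈ Finset.range n, (Polynomial.X + Polynomial.C i) : Polynomial ℕ)).map
      (Nat.castRingHom ℚ) = Q := by
    rw [Polynomial.map_prod]
    simp [hQ]
  have h1 : ∏ i ∈ Finset.Icc 1 (n+1), (Polynomial.X + Polynomial.C ((i : ℚ) - ((1:ℕ) : ℚ)))
      = Q * (Polynomial.X + Polynomial.C (n : ℚ)) := by
    rw [← Finset.Ico_add_one_right_eq_Icc, Finset.prod_Ico_eq_prod_range, hQ,
      ← Finset.prod_range_succ (fun i : ℕ => (Polynomial.X + Polynomial.C (i : ℚ)))]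
    apply Finset.prod_congr (by simp)
    intro i _
    congr 2
    push_cast
    ring
  have h2 : ∏ i ∈ Finset.Icc 1 (n+1), (Polynomial.X + Polynomial.C ((i : ℚ) - ((2:ℕ) : ℚ)))
      = Q * (Polynomial.X - 1) := by
    rw [← Finset.Ico_add_one_right_eq_Icc, Finset.prod_Ico_eq_prod_range]
    rw [show n + 1 + 1 - 1 = n + 1 by omega, Finset.prod_range_succ', hQ]
    congr 1
    · apply Finset.prod_congr rfl
      intro i _
      congr 2
      push_cast
      ring
    · norm_num
      ring
  have h3 : Polynomial.C ((n.factorial : ℚ)) * (Polynomial.C (n : ℚ) *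
        ((((n+1).factorial : ℚ))⁻¹ • (Q * (Polynomial.X - 1))) +
      (((n+1).factorial : ℚ))⁻¹ • (Q * (Polynomial.X + Polynomial.C (n : ℚ)))) = Q * Polynomial.X := by
    rw [Polynomial.smul_eq_C_mul, Polynomial.smul_eq_C_mul]
    have h4 : Polynomial.C (n.factorial : ℚ) * Polynomial.C (((n+1).factorial : ℚ))⁻¹ *
        (Polynomial.C (n : ℚ) + 1) = 1 := by
      rw [← Polynomial.C_1, ← Polynomial.C_add, ← Polynomial.C_mul, ← Polynomial.C_mul]
      congr 1
      rw [Nat.factorial_succ]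
      push_cast
      have : (n.factorial : ℚ) ≠ 0 := by positivity
      field_simp
    linear_combination (Q * Polynomial.X) * h4
  have h5 := congrArg (fun p => p.coeff (l+1)) h3
  simp only [Polynomial.coeff_C_mul, Polynomial.coeff_add, Polynomial.coeff_mul_X] at h5
  unfold aCoeff
  rw [h1, h2, h5, ← hQc, Polynomial.coeff_map]
  simp

/-- The span of the conjugates of `ẽ⁽ˡ⁾ₖ * τₖ` in `ℚ[Sₖ]` has dimension the
coefficient of `q^{l-1}` in `q(q+1)⋯(q+k-2)`. -/
theorem finrank_span_conjugates_eulConjTau (k l : ℕ) (hk : 2 ≤ k) (hl1 : 1 ≤ l) (hlk : l ≤ k) :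
    Module.finrank ℚ (Submodule.span ℚ (Set.range fun σ : Equiv.Perm (Fin k) =>
        MonoidAlgebra.single σ (1 : ℚ) * eulConjTau k l * MonoidAlgebra.single σ⁻¹ (1 : ℚ))) =
      ((∏ i ∈ Finset.range (k - 1), (Polynomial.X + Polynomial.C i) : Polynomial ℕ)).coeff
        (l - 1) := by
  obtain ⟨n, rfl⟩ : ∃ n, k = n + 1 := ⟨k - 1, by omega⟩
  rw [span_eq, finrank_eq]
  have h := finrank_range_mulRight _ (eul_avg_idem n l (by omega))
  rw [coeff_eul_avg, cdes_one (by omega), Fintype.card_perm, Fintype.card_fin] at h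
  have h2 := aCoeff_combo n l hl1
  have h3 : (((n+1).factorial : ℕ) : ℚ) * (((n:ℚ)+1)⁻¹ * ((n+1) * aCoeff (n+1) l (1 + 1) +
      (1 : ℕ) * (aCoeff (n+1) l 1 - aCoeff (n+1) l (1 + 1)))) =
      (n.factorial : ℚ) * (n * aCoeff (n+1) l 2 + aCoeff (n+1) l 1) := by
    rw [Nat.factorial_succ]
    push_cast
    have : (n : ℚ) + 1 ≠ 0 := by positivity
    field_simp
    ring
  rw [h3, h2] at h
  exact_mod_cast h
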